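/- Let φ, ψ : U^n → U^n be holomorphic, and suppose the difference of composition operators C_φ − C_ψ : B → H^∞, f ↦ f∘φ − f∘ψ, is a bounded linear operator from the Bloch space B of U^n to H^∞(U^n). Then the essential norm satisfies ‖C_φ − C_ψ‖_e ≤ 2n² · lim_{δ→0⁺} sup_{z∈E_δ} k_{U^n}(φ(z), ψ(z)), where E_δ = {z ∈ U^n : max(|||φ(z)|||, |||ψ(z)|||) > 1 − δ}. -/

import Mathlib

open Complex Metric Set Filter
open scoped Topology BigOperators

noncomputable section

/-- The unit polydisc `U^n` in `ℂ^n`; the norm on `Fin n → ℂ` is the sup norm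
`|||z||| = max_j |z_j|`. -/
def polyDisc (n : ℕ) : Set (Fin n → ℂ) := {z | ‖z‖ < 1}

/-- `Σ_{j=1}^n (1 - |z_j|²) |∂f/∂z_j(z)|`. -/
def blochSum (n : ℕ) (f : (Fin n → ℂ) → ℂ) (z : Fin n → ℂ) : ℝ :=
  ∑ j : Fin n, (1 - ‖z j‖ ^ 2) * ‖fderiv ℂ f z (Pi.single j 1)‖

/-- The Bloch norm `‖f‖ = |f(0)| + sup_{z ∈ Uⁿ} Σ_j (1-|z_j|²)|∂f/∂z_j(z)|`. -/
def blochNorm (n : ℕ) (f : (Fin n → ℂ) → ℂ) : ℝ :=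
  ‖f 0‖ + sSup (blochSum n f '' polyDisc n)

/-- Membership in the Bloch space of `Uⁿ`: holomorphic on `Uⁿ` with finite Bloch norm. -/
def InBloch (n : ℕ) (f : (Fin n → ℂ) → ℂ) : Prop :=
  DifferentiableOn ℂ f (polyDisc n) ∧ BddAbove (blochSum n f '' polyDisc n)

/-- The Möbius automorphism `φ_a` of the polydisc:
`φ_a(w)_j = (w_j - a_j)/(1 - conj(a_j) w_j)`. -/
def mobius (n : ℕ) (a w : Fin n → ℂ) : Fin n → ℂ :=
  fun j => (w j - a j) / (1 - (starRingEnd ℂ) (a j) * w j)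

/-- The Kobayashi distance on the polydisc:
`k_{Uⁿ}(z,w) = (1/2) log((1 + |||φ_z(w)|||)/(1 - |||φ_z(w)|||))`. -/
def kobayashi (n : ℕ) (z w : Fin n → ℂ) : ℝ :=
  (1 / 2) * Real.log ((1 + ‖mobius n z w‖) / (1 - ‖mobius n z w‖))

/-- The `H^∞` (sup) norm of `g` over the polydisc: `‖g‖_∞ = sup_{z ∈ Uⁿ} |g(z)|`. -/
def supNorm (n : ℕ) (g : (Fin n → ℂ) → ℂ) : ℝ :=
  ⨆ z : polyDisc n, ‖g (z : Fin n → ℂ)‖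

/-- The difference of composition operators `C_φ - C_ψ : f ↦ f∘φ - f∘ψ`. -/
def compOpDiff (n : ℕ) (φ ψ : (Fin n → ℂ) → Fin n → ℂ) :
    ((Fin n → ℂ) → ℂ) → (Fin n → ℂ) → ℂ :=
  fun f => f ∘ φ - f ∘ ψ

/-- Boundedness of an operator from the Bloch space to `H^∞`. -/
def IsBddOp (n : ℕ) (T : ((Fin n → ℂ) → ℂ) → (Fin n → ℂ) → ℂ) : Prop :=
  ∃ C : ℝ, ∀ f, InBloch n f → supNorm n (T f) ≤ C * blochNorm n f

/-- The operator norm of `T` from the Bloch space to `H^∞`: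
the supremum of `‖T f‖_∞` over the unit ball of the Bloch space. -/
def opNorm (n : ℕ) (T : ((Fin n → ℂ) → ℂ) → (Fin n → ℂ) → ℂ) : ℝ :=
  sSup {t : ℝ | ∃ f, InBloch n f ∧ blochNorm n f ≤ 1 ∧ t = supNorm n (T f)}

/-- `T` is linear on the Bloch space (values only matter on the polydisc). -/
def IsLinOp (n : ℕ) (T : ((Fin n → ℂ) → ℂ) → (Fin n → ℂ) → ℂ) : Prop :=
  (∀ f g, InBloch n f → InBloch n g →
    ∀ z ∈ polyDisc n, T (f + g) z = T f z + T g z) ∧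
  (∀ (c : ℂ) (f), InBloch n f → ∀ z ∈ polyDisc n, T (c • f) z = c * T f z)

/-- `T` sends Bloch functions to `H^∞` functions (bounded and holomorphic on `Uⁿ`). -/
def MapsToHinf (n : ℕ) (T : ((Fin n → ℂ) → ℂ) → (Fin n → ℂ) → ℂ) : Prop :=
  ∀ f, InBloch n f → DifferentiableOn ℂ (T f) (polyDisc n) ∧
    BddAbove ((fun z => ‖T f z‖) '' polyDisc n)

/-- Compactness of a linear operator `T` from the Bloch space to `H^∞`:
every sequence in the unit ball of the Bloch space has a subsequence whose image
under `T` is Cauchy in the `H^∞` norm. -/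
def IsCompactOp (n : ℕ) (T : ((Fin n → ℂ) → ℂ) → (Fin n → ℂ) → ℂ) : Prop :=
  IsLinOp n T ∧ MapsToHinf n T ∧
  ∀ F : ℕ → (Fin n → ℂ) → ℂ, (∀ m, InBloch n (F m) ∧ blochNorm n (F m) ≤ 1) →
    ∃ s : ℕ → ℕ, StrictMono s ∧
      ∀ ε : ℝ, 0 < ε → ∃ N : ℕ, ∀ k ≥ N, ∀ k' ≥ N,
        supNorm n (T (F (s k)) - T (F (s k'))) ≤ ε

/-- The essential norm of `T : B → H^∞`: the distance from `T` to the compact operators,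
`‖T‖_e = inf {‖T - K‖ : K compact}`. -/
def essNorm (n : ℕ) (T : ((Fin n → ℂ) → ℂ) → (Fin n → ℂ) → ℂ) : ℝ :=
  sInf {t : ℝ | ∃ K, IsCompactOp n K ∧ t = opNorm n (T - K)}

/-- `E_δ = {z ∈ Uⁿ : max(|||φ(z)|||, |||ψ(z)|||) > 1 - δ}`. -/
def Eset (n : ℕ) (φ ψ : (Fin n → ℂ) → Fin n → ℂ) (δ : ℝ) : Set (Fin n → ℂ) :=
  {z ∈ polyDisc n | 1 - δ < max ‖φ z‖ ‖ψ z‖}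

lemma isOpen_polyDisc (n : ℕ) : IsOpen (polyDisc n) :=
  isOpen_lt continuous_norm continuous_const

lemma norm_coord_lt_one {n : ℕ} {z : Fin n → ℂ} (hz : z ∈ polyDisc n) (j : Fin n) :
    ‖z j‖ < 1 :=
  (norm_le_pi_norm z j).trans_lt hz

lemma one_sub_norm_sq_pos {z : ℂ} (hz : ‖z‖ < 1) : 0 < 1 - ‖z‖ ^ 2 := by
  nlinarith [norm_nonneg z]

lemma smul_mem_polyDisc {n : ℕ} {z : Fin n → ℂ} (hz : z ∈ polyDisc n) {r : ℝ} (h0 : 0 ≤ r)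
    (h1 : r ≤ 1) : (r : ℂ) • z ∈ polyDisc n := by
  change ‖(r : ℂ) • z‖ < 1
  rw [norm_smul, Complex.norm_real, Real.norm_of_nonneg h0]
  exact (mul_le_of_le_one_left (norm_nonneg z) h1).trans_lt hz

lemma blochSum_nonneg {n : ℕ} (f : (Fin n → ℂ) → ℂ) {z : Fin n → ℂ} (hz : z ∈ polyDisc n) :
    0 ≤ blochSum n f z :=
  Finset.sum_nonneg fun j _ =>
    mul_nonneg (one_sub_norm_sq_pos (norm_coord_lt_one hz j)).le (norm_nonneg _)

lemma blochNorm_nonneg (n : ℕ) (f : (Fin n → ℂ) → ℂ) : 0 ≤ blochNorm n f := by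
  refine add_nonneg (norm_nonneg _) (Real.sSup_nonneg ?_)
  rintro _ ⟨z, hz, rfl⟩
  exact blochSum_nonneg f hz

lemma norm_apply_zero_le_blochNorm (n : ℕ) (f : (Fin n → ℂ) → ℂ) : ‖f 0‖ ≤ blochNorm n f := by
  refine le_add_of_nonneg_right (Real.sSup_nonneg ?_)
  rintro _ ⟨z, hz, rfl⟩
  exact blochSum_nonneg f hz

lemma InBloch.blochSum_le_blochNorm {n : ℕ} {f : (Fin n → ℂ) → ℂ} (hf : InBloch n f)
    {z : Fin n → ℂ} (hz : z ∈ polyDisc n) : blochSum n f z ≤ blochNorm n f :=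
  (le_csSup hf.2 (mem_image_of_mem _ hz)).trans (le_add_of_nonneg_left (norm_nonneg _))

lemma InBloch.of_blochSum_le {n : ℕ} {f : (Fin n → ℂ) → ℂ} {M : ℝ}
    (hf : DifferentiableOn ℂ f (polyDisc n)) (hM : ∀ z ∈ polyDisc n, blochSum n f z ≤ M) :
    InBloch n f := by
  refine ⟨hf, M, ?_⟩
  rintro _ ⟨z, hz, rfl⟩
  exact hM z hz

lemma blochNorm_le {n : ℕ} {f : (Fin n → ℂ) → ℂ} {M : ℝ} (hM0 : 0 ≤ M)
    (hM : ∀ z ∈ polyDisc n, blochSum n f z ≤ M) : blochNorm n f ≤ ‖f 0‖ + M := by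
  refine add_le_add le_rfl (Real.sSup_le ?_ hM0)
  rintro _ ⟨z, hz, rfl⟩
  exact hM z hz

lemma norm_fderiv_apply_le {n : ℕ} (f : (Fin n → ℂ) → ℂ) (z v : Fin n → ℂ) :
    ‖fderiv ℂ f z v‖ ≤ ∑ j, ‖v j‖ * ‖fderiv ℂ f z (Pi.single j 1)‖ := by
  conv_lhs => rw [pi_eq_sum_univ' v, map_sum]
  refine (norm_sum_le _ _).trans (Finset.sum_le_sum fun j _ => ?_)
  rw [map_smul, norm_smul]

/-- On a smaller closed polydisc a function with bounded Bloch sum is Lipschitz. -/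
lemma norm_sub_le_mul_norm_sub {n : ℕ} {f : (Fin n → ℂ) → ℂ} {M R : ℝ}
    (hf : DifferentiableOn ℂ f (polyDisc n)) (hM : ∀ z ∈ polyDisc n, blochSum n f z ≤ M)
    (hR : R < 1) {x y : Fin n → ℂ} (hx : ‖x‖ ≤ R) (hy : ‖y‖ ≤ R) :
    ‖f x - f y‖ ≤ M / (1 - R) * ‖x - y‖ := by
  have hmem : ∀ z ∈ closedBall (0 : Fin n → ℂ) R, z ∈ polyDisc n := fun z hz =>
    (mem_closedBall_zero_iff.1 hz).trans_lt hR
  refine (convex_closedBall (0 : Fin n → ℂ) R).norm_image_sub_le_of_norm_fderiv_le (𝕜 := ℂ)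
    (fun z hz => (hf z (hmem z hz)).differentiableAt ((isOpen_polyDisc n).mem_nhds (hmem z hz)))
    (fun z hz => ?_) (mem_closedBall_zero_iff.2 hy) (mem_closedBall_zero_iff.2 hx)
  have hM0 : 0 ≤ M := (blochSum_nonneg f (hmem z hz)).trans (hM z (hmem z hz))
  refine ContinuousLinearMap.opNorm_le_bound _ (div_nonneg hM0 (by linarith)) fun v => ?_
  rw [div_mul_eq_mul_div, le_div_iff₀ (by linarith)]
  calc ‖fderiv ℂ f z v‖ * (1 - R)
      ≤ (∑ j, ‖v j‖ * ‖fderiv ℂ f z (Pi.single j 1)‖) * (1 - R) :=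
        mul_le_mul_of_nonneg_right (norm_fderiv_apply_le f z v) (by linarith)
    _ = ∑ j, ‖v j‖ * ((1 - R) * ‖fderiv ℂ f z (Pi.single j 1)‖) := by
        rw [Finset.sum_mul]; exact Finset.sum_congr rfl fun j _ => by ring
    _ ≤ ∑ j, ‖v‖ * ((1 - ‖z j‖ ^ 2) * ‖fderiv ℂ f z (Pi.single j 1)‖) := by
        refine Finset.sum_le_sum fun j _ => ?_
        have h1 : ‖z j‖ ≤ R := (norm_le_pi_norm z j).trans (mem_closedBall_zero_iff.1 hz)
        have h2 : 1 - R ≤ 1 - ‖z j‖ ^ 2 := by nlinarith [norm_nonneg (z j)]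
        have h3 := norm_le_pi_norm v j
        have h4 : 0 ≤ 1 - R := by linarith
        gcongr
    _ = blochSum n f z * ‖v‖ := by rw [← Finset.mul_sum, mul_comm, blochSum]
    _ ≤ M * ‖v‖ := mul_le_mul_of_nonneg_right (hM z (hmem z hz)) (norm_nonneg v)

lemma norm_sq_sub_norm_sq_mobius (a x : ℂ) :
    ‖1 - (starRingEnd ℂ) a * x‖ ^ 2 - ‖x - a‖ ^ 2 = (1 - ‖a‖ ^ 2) * (1 - ‖x‖ ^ 2) := by
  simp only [Complex.sq_norm, Complex.normSq_apply, Complex.sub_re, Complex.sub_im,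
    Complex.mul_re, Complex.mul_im, Complex.conj_re, Complex.conj_im, Complex.one_re,
    Complex.one_im]
  ring

lemma one_sub_conj_mul_ne_zero {a x : ℂ} (ha : ‖a‖ < 1) (hx : ‖x‖ < 1) :
    1 - (starRingEnd ℂ) a * x ≠ 0 := by
  intro h
  have h1 := norm_sq_sub_norm_sq_mobius a x
  rw [h, norm_zero] at h1
  nlinarith [mul_pos (one_sub_norm_sq_pos ha) (one_sub_norm_sq_pos hx), sq_nonneg ‖x - a‖]

lemma one_sub_norm_sq_mobius {a x : ℂ} (ha : ‖a‖ < 1) (hx : ‖x‖ < 1) :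
    1 - ‖(x - a) / (1 - (starRingEnd ℂ) a * x)‖ ^ 2 =
      (1 - ‖a‖ ^ 2) * (1 - ‖x‖ ^ 2) / ‖1 - (starRingEnd ℂ) a * x‖ ^ 2 := by
  have h := norm_ne_zero_iff.2 (one_sub_conj_mul_ne_zero ha hx)
  rw [← norm_sq_sub_norm_sq_mobius, norm_div, div_pow, sub_div, div_self (pow_ne_zero 2 h)]

lemma norm_mobius_coord_lt_one {a x : ℂ} (ha : ‖a‖ < 1) (hx : ‖x‖ < 1) :
    ‖(x - a) / (1 - (starRingEnd ℂ) a * x)‖ < 1 := by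
  have h := norm_pos_iff.2 (one_sub_conj_mul_ne_zero ha hx)
  have h1 : 0 < 1 - ‖(x - a) / (1 - (starRingEnd ℂ) a * x)‖ ^ 2 := by
    rw [one_sub_norm_sq_mobius ha hx]
    have := one_sub_norm_sq_pos ha
    have := one_sub_norm_sq_pos hx
    positivity
  exact (sq_lt_one_iff₀ (norm_nonneg _)).1 (by linarith)

lemma mobius_mem_polyDisc {n : ℕ} {a b : Fin n → ℂ} (ha : a ∈ polyDisc n)
    (hb : b ∈ polyDisc n) : mobius n a b ∈ polyDisc n :=
  (pi_norm_lt_iff one_pos).2 fun j =>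
    norm_mobius_coord_lt_one (norm_coord_lt_one ha j) (norm_coord_lt_one hb j)

lemma neg_mem_polyDisc {n : ℕ} {a : Fin n → ℂ} (ha : a ∈ polyDisc n) : -a ∈ polyDisc n := by
  change ‖-a‖ < 1
  rwa [norm_neg]

lemma mobius_neg_zero (n : ℕ) (a : Fin n → ℂ) : mobius n (-a) 0 = a := by
  ext j
  simp [mobius]

lemma mobius_neg_mobius {n : ℕ} {a b : Fin n → ℂ} (ha : a ∈ polyDisc n)
    (hb : b ∈ polyDisc n) : mobius n (-a) (mobius n a b) = b := by
  ext j
  have h1 := one_sub_conj_mul_ne_zero (norm_coord_lt_one ha j) (norm_coord_lt_one hb j)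
  have h3 := one_sub_conj_mul_ne_zero (norm_coord_lt_one (neg_mem_polyDisc ha) j)
    (norm_coord_lt_one (mobius_mem_polyDisc ha hb) j)
  change (mobius n a b j - (-a) j) / (1 - (starRingEnd ℂ) ((-a) j) * mobius n a b j) = b j
  rw [div_eq_iff h3]
  have hq : mobius n a b j * (1 - (starRingEnd ℂ) (a j) * b j) = b j - a j :=
    div_mul_cancel₀ _ h1
  simp only [Pi.neg_apply, map_neg]
  refine mul_right_cancel₀ h1 ?_
  linear_combination (1 - b j * (starRingEnd ℂ) (a j)) * hq

/-- The curve `s ↦ φ_a(s w)` in the disc, with its hyperbolic speed. -/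
lemma exists_hasDerivAt_mobius_coord {a w : ℂ} {ρ s : ℝ} (ha : ‖a‖ < 1) (hw : ‖w‖ ≤ ρ)
    (hρ : ρ < 1) (hs : s ∈ Icc (0 : ℝ) 1) :
    ∃ d : ℂ, HasDerivAt
      (fun t : ℝ => ((t : ℂ) * w - a) / (1 - (starRingEnd ℂ) a * ((t : ℂ) * w))) d s ∧
      ‖d‖ ≤ (1 - ‖((s : ℂ) * w - a) / (1 - (starRingEnd ℂ) a * ((s : ℂ) * w))‖ ^ 2) *
        (ρ / (1 - (ρ * s) ^ 2)) := by
  have hρ0 : 0 ≤ ρ := (norm_nonneg w).trans hw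
  have hsw : ‖(s : ℂ) * w‖ ≤ ρ * s := by
    rw [norm_mul, Complex.norm_real, Real.norm_of_nonneg hs.1, mul_comm]
    exact mul_le_mul_of_nonneg_right hw hs.1
  have hρs : ρ * s < 1 := (mul_le_of_le_one_right hρ0 hs.2).trans_lt hρ
  have hx : ‖(s : ℂ) * w‖ < 1 := hsw.trans_lt hρs
  have hne := one_sub_conj_mul_ne_zero ha hx
  have hlin : HasDerivAt (fun t : ℝ => (t : ℂ) * w) w s := by
    simpa using (Complex.ofRealCLM.hasDerivAt (x := s)).mul_const w
  have hd := (hlin.sub_const a).div ((hlin.const_mul ((starRingEnd ℂ) a)).const_sub 1) hne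
  refine ⟨_, hd, ?_⟩
  have hnum : w * (1 - (starRingEnd ℂ) a * ((s : ℂ) * w)) -
      ((s : ℂ) * w - a) * -((starRingEnd ℂ) a * w) = ((1 - ‖a‖ ^ 2 : ℝ) : ℂ) * w := by
    push_cast
    rw [← Complex.mul_conj']
    ring
  rw [hnum, one_sub_norm_sq_mobius ha hx, norm_div, norm_pow, norm_mul, Complex.norm_real,
    Real.norm_of_nonneg (one_sub_norm_sq_pos ha).le, div_mul_eq_mul_div]
  have h1 := one_sub_norm_sq_pos ha
  have h2 : 0 < 1 - (ρ * s) ^ 2 := by nlinarith [mul_nonneg hρ0 hs.1]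
  have h3 : (ρ * s) ^ 2 ≥ ‖(s : ℂ) * w‖ ^ 2 := pow_le_pow_left₀ (norm_nonneg _) hsw 2
  gcongr ?_ / _
  rw [mul_assoc]
  refine mul_le_mul_of_nonneg_left ?_ h1.le
  rw [mul_div_assoc', le_div_iff₀ h2]
  nlinarith [norm_nonneg w]

lemma hasDerivAt_half_log {ρ s : ℝ} (h0 : 0 ≤ ρ * s) (h1 : ρ * s < 1) :
    HasDerivAt (fun t : ℝ => (1 / 2) * Real.log ((1 + ρ * t) / (1 - ρ * t)))
      (ρ / (1 - (ρ * s) ^ 2)) s := by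
  have hl : HasDerivAt (fun t : ℝ => ρ * t) ρ s := by
    simpa using (hasDerivAt_id s).const_mul ρ
  have hp : 1 + ρ * s ≠ 0 := by linarith
  have hm : 1 - ρ * s ≠ 0 := by linarith
  have := (((hl.const_add 1).div (hl.const_sub 1) hm).log (div_ne_zero hp hm)).const_mul (1 / 2)
  refine this.congr_deriv ?_
  simp only [Pi.div_apply]
  rw [show 1 - (ρ * s) ^ 2 = (1 + ρ * s) * (1 - ρ * s) by ring]
  field_simp
  ring

/-- A function with Bloch sum bounded by `M` is `M`-Lipschitz for the Kobayashi distance. -/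
lemma norm_sub_le_mul_kobayashi {n : ℕ} {f : (Fin n → ℂ) → ℂ} {M : ℝ}
    (hf : DifferentiableOn ℂ f (polyDisc n)) (hM : ∀ z ∈ polyDisc n, blochSum n f z ≤ M)
    {a b : Fin n → ℂ} (ha : a ∈ polyDisc n) (hb : b ∈ polyDisc n) :
    ‖f a - f b‖ ≤ M * kobayashi n a b := by
  set w := mobius n a b with hw
  have hwmem : w ∈ polyDisc n := mobius_mem_polyDisc ha hb
  have hρ1 : ‖w‖ < 1 := hwmem
  set γ : ℝ → Fin n → ℂ := fun s => mobius n (-a) ((s : ℂ) • w) with hγ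
  have hγmem : ∀ s ∈ Icc (0 : ℝ) 1, γ s ∈ polyDisc n := fun s hs =>
    mobius_mem_polyDisc (neg_mem_polyDisc ha) (smul_mem_polyDisc hwmem hs.1 hs.2)
  have hρs : ∀ s ∈ Icc (0 : ℝ) 1, 0 ≤ ‖w‖ * s ∧ ‖w‖ * s < 1 := fun s hs =>
    ⟨mul_nonneg (norm_nonneg w) hs.1,
      (mul_le_of_le_one_right (norm_nonneg w) hs.2).trans_lt hρ1⟩
  have hex : ∀ s ∈ Icc (0 : ℝ) 1, ∃ d : Fin n → ℂ, HasDerivAt γ d s ∧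
      ∀ j, ‖d j‖ ≤ (1 - ‖γ s j‖ ^ 2) * (‖w‖ / (1 - (‖w‖ * s) ^ 2)) := by
    intro s hs
    choose d hd hdle using fun j => exists_hasDerivAt_mobius_coord
      (norm_coord_lt_one (neg_mem_polyDisc ha) j) (norm_le_pi_norm w j) hρ1 hs
    exact ⟨d, hasDerivAt_pi.2 hd, hdle⟩
  choose! d hd hdle using hex
  have hG : ∀ s ∈ Icc (0 : ℝ) 1,
      HasDerivAt (fun t => f (γ t) - f a) (fderiv ℂ f (γ s) (d s)) s := by
    intro s hs
    have h1 := ((hf _ (hγmem s hs)).differentiableAt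
      ((isOpen_polyDisc n).mem_nhds (hγmem s hs))).hasFDerivAt.restrictScalars ℝ
    exact (h1.comp_hasDerivAt s (hd s hs)).sub_const (f a)
  have hB : ∀ s ∈ Icc (0 : ℝ) 1, HasDerivAt
      (fun t : ℝ => M * ((1 / 2) * Real.log ((1 + ‖w‖ * t) / (1 - ‖w‖ * t))))
      (M * (‖w‖ / (1 - (‖w‖ * s) ^ 2))) s := fun s hs =>
    (hasDerivAt_half_log (hρs s hs).1 (hρs s hs).2).const_mul M
  have hγ0 : γ 0 = a := by simp [hγ, mobius_neg_zero]
  have hγ1 : γ 1 = b := by simp [hγ, hw, mobius_neg_mobius ha hb]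
  have key := image_norm_le_of_norm_deriv_right_le_deriv_boundary'
    (fun s hs => (hG s hs).continuousAt.continuousWithinAt)
    (fun s hs => (hG s (Ico_subset_Icc_self hs)).hasDerivWithinAt)
    (by simp [hγ0]) (fun s hs => (hB s hs).continuousAt.continuousWithinAt)
    (fun s hs => (hB s (Ico_subset_Icc_self hs)).hasDerivWithinAt) ?_
    (right_mem_Icc.2 zero_le_one)
  · rw [norm_sub_rev]
    simpa [hγ1, kobayashi, ← hw] using key
  · intro s hs'
    have hs := Ico_subset_Icc_self hs'
    have hc : 0 ≤ ‖w‖ / (1 - (‖w‖ * s) ^ 2) :=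
      div_nonneg (norm_nonneg w) (by nlinarith [hρs s hs])
    calc ‖fderiv ℂ f (γ s) (d s)‖
        ≤ ∑ j, ‖d s j‖ * ‖fderiv ℂ f (γ s) (Pi.single j 1)‖ := norm_fderiv_apply_le f _ _
      _ ≤ ∑ j, ((1 - ‖γ s j‖ ^ 2) * (‖w‖ / (1 - (‖w‖ * s) ^ 2))) *
            ‖fderiv ℂ f (γ s) (Pi.single j 1)‖ :=
          Finset.sum_le_sum fun j _ =>
            mul_le_mul_of_nonneg_right (hdle s hs j) (norm_nonneg _)
      _ = blochSum n f (γ s) * (‖w‖ / (1 - (‖w‖ * s) ^ 2)) := by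
          rw [blochSum, Finset.sum_mul]
          exact Finset.sum_congr rfl fun j _ => by ring
      _ ≤ M * (‖w‖ / (1 - (‖w‖ * s) ^ 2)) :=
          mul_le_mul_of_nonneg_right (hM _ (hγmem s hs)) hc

lemma kobayashi_nonneg {n : ℕ} {a b : Fin n → ℂ} (ha : a ∈ polyDisc n) (hb : b ∈ polyDisc n) :
    0 ≤ kobayashi n a b := by
  have h1 : ‖mobius n a b‖ < 1 := mobius_mem_polyDisc ha hb
  have h0 := norm_nonneg (mobius n a b)
  refine mul_nonneg (by norm_num) (Real.log_nonneg ?_)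
  rw [le_div_iff₀ (by linarith)]
  linarith

lemma differentiableOn_comp_smul {n : ℕ} {f : (Fin n → ℂ) → ℂ}
    (hf : DifferentiableOn ℂ f (polyDisc n)) {r : ℝ} (h0 : 0 ≤ r) (h1 : r ≤ 1) :
    DifferentiableOn ℂ (fun w => f ((r : ℂ) • w)) (polyDisc n) :=
  hf.comp (differentiable_id.const_smul (r : ℂ)).differentiableOn
    fun _ hz => smul_mem_polyDisc hz h0 h1

lemma blochSum_comp_smul_le {n : ℕ} (f : (Fin n → ℂ) → ℂ) {r : ℝ} (h0 : 0 ≤ r) (h1 : r ≤ 1)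
    {z : Fin n → ℂ} (hz : z ∈ polyDisc n) :
    blochSum n (fun w => f ((r : ℂ) • w)) z ≤ blochSum n f ((r : ℂ) • z) := by
  refine Finset.sum_le_sum fun j _ => ?_
  have h2 := one_sub_norm_sq_pos (norm_coord_lt_one hz j)
  rw [fderiv_comp_smul, smul_apply, norm_smul, Pi.smul_apply, norm_smul,
    Complex.norm_real, Real.norm_of_nonneg h0, ← mul_assoc]
  refine mul_le_mul_of_nonneg_right ?_ (norm_nonneg _)
  have h3 : (r * ‖z j‖) ^ 2 ≤ ‖z j‖ ^ 2 := by
    gcongr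
    exact mul_le_of_le_one_left (norm_nonneg _) h1
  nlinarith

lemma exists_norm_comp_smul_le {n : ℕ} {f : (Fin n → ℂ) → ℂ}
    (hf : DifferentiableOn ℂ f (polyDisc n)) {r : ℝ} (h0 : 0 ≤ r) (h1 : r < 1) :
    ∃ C, ∀ z ∈ polyDisc n, ‖f ((r : ℂ) • z)‖ ≤ C := by
  have hsub : closedBall (0 : Fin n → ℂ) r ⊆ polyDisc n := fun z hz =>
    (mem_closedBall_zero_iff.1 hz).trans_lt h1
  obtain ⟨C, hC⟩ := (isCompact_closedBall (0 : Fin n → ℂ) r).exists_bound_of_continuousOn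
    (hf.continuousOn.mono hsub)
  refine ⟨C, fun z hz => hC _ (mem_closedBall_zero_iff.2 ?_)⟩
  rw [norm_smul, Complex.norm_real, Real.norm_of_nonneg h0]
  exact mul_le_of_le_one_right h0 (le_of_lt hz)

lemma one_sub_conj_mul_mem_slitPlane {a x : ℂ} (ha : ‖a‖ < 1) (hx : ‖x‖ ≤ 1) :
    1 - (starRingEnd ℂ) a * x ∈ slitPlane := by
  refine Or.inl ?_
  have h1 : ‖(starRingEnd ℂ) a * x‖ < 1 := by
    rw [norm_mul, RCLike.norm_conj]
    exact (mul_le_of_le_one_right (norm_nonneg a) hx).trans_lt ha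
  have h2 := Complex.re_le_norm ((starRingEnd ℂ) a * x)
  rw [Complex.sub_re, Complex.one_re]
  linarith

lemma hasFDerivAt_log_one_sub {n : ℕ} {a : ℂ} (ha : ‖a‖ < 1) (j : Fin n) {z : Fin n → ℂ}
    (hz : z ∈ polyDisc n) :
    HasFDerivAt (fun w : Fin n → ℂ => Complex.log (1 - (starRingEnd ℂ) a * w j))
      ((1 - (starRingEnd ℂ) a * z j)⁻¹ • -((starRingEnd ℂ) a •
        (ContinuousLinearMap.proj j : (Fin n → ℂ) →L[ℂ] ℂ))) z :=
  (((hasFDerivAt_apply j z).const_mul ((starRingEnd ℂ) a)).const_sub 1).clog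
    (one_sub_conj_mul_mem_slitPlane ha (norm_coord_lt_one hz j).le)

lemma blochSum_log_one_sub_le {n : ℕ} {a : ℂ} (ha : ‖a‖ < 1) (j : Fin n) {z : Fin n → ℂ}
    (hz : z ∈ polyDisc n) :
    blochSum n (fun w => Complex.log (1 - (starRingEnd ℂ) a * w j)) z ≤ 2 := by
  have hzj := norm_coord_lt_one hz j
  rw [blochSum, Finset.sum_eq_single j]
  · rw [(hasFDerivAt_log_one_sub ha j hz).fderiv]
    simp only [smul_apply, neg_apply,
      ContinuousLinearMap.proj_apply, Pi.single_eq_same, smul_eq_mul, mul_one, norm_mul,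
      norm_inv, norm_neg, RCLike.norm_conj]
    have hpos := norm_pos_iff.2 (one_sub_conj_mul_ne_zero ha hzj)
    have hge : 1 - ‖z j‖ ≤ ‖1 - (starRingEnd ℂ) a * z j‖ := by
      have h1 := norm_sub_norm_le (1 : ℂ) ((starRingEnd ℂ) a * z j)
      rw [norm_one, norm_mul, RCLike.norm_conj] at h1
      nlinarith [norm_nonneg (z j)]
    rw [mul_left_comm, inv_mul_le_iff₀ hpos]
    nlinarith [norm_nonneg (z j), norm_nonneg a, one_sub_norm_sq_pos hzj]
  · intro i _ hi
    rw [(hasFDerivAt_log_one_sub ha j hz).fderiv]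
    simp [Pi.single_eq_of_ne hi.symm]
  · simp

/-- Functions bounded near the polydisc inherit a pointwise estimate from `IsBddOp`. -/
lemma norm_compOpDiff_apply_le {n : ℕ} {φ ψ : (Fin n → ℂ) → Fin n → ℂ}
    (hφm : MapsTo φ (polyDisc n) (polyDisc n)) (hψm : MapsTo ψ (polyDisc n) (polyDisc n))
    {f : (Fin n → ℂ) → ℂ} {B : ℝ} (hB : ∀ z ∈ polyDisc n, ‖f z‖ ≤ B)
    {z : Fin n → ℂ} (hz : z ∈ polyDisc n) :
    ‖f (φ z) - f (ψ z)‖ ≤ supNorm n (compOpDiff n φ ψ f) := by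
  refine le_ciSup (f := fun z : polyDisc n => ‖compOpDiff n φ ψ f z‖) ⟨B + B, ?_⟩ ⟨z, hz⟩
  rintro _ ⟨w, rfl⟩
  exact (norm_sub_le _ _).trans (add_le_add (hB _ (hφm w.2)) (hB _ (hψm w.2)))

lemma exists_norm_log_one_sub_sub_le {n : ℕ} {φ ψ : (Fin n → ℂ) → Fin n → ℂ}
    (hφm : MapsTo φ (polyDisc n) (polyDisc n)) (hψm : MapsTo ψ (polyDisc n) (polyDisc n))
    (hbdd : IsBddOp n (compOpDiff n φ ψ)) :
    ∃ C : ℝ, ∀ a : ℂ, ‖a‖ < 1 → ∀ j, ∀ z ∈ polyDisc n,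
      ‖Complex.log (1 - (starRingEnd ℂ) a * φ z j) -
        Complex.log (1 - (starRingEnd ℂ) a * ψ z j)‖ ≤ C := by
  obtain ⟨C, hC⟩ := hbdd
  refine ⟨|C| * 2, fun a ha j z hz => ?_⟩
  set f : (Fin n → ℂ) → ℂ := fun w => Complex.log (1 - (starRingEnd ℂ) a * w j) with hf
  have hsum : ∀ z ∈ polyDisc n, blochSum n f z ≤ 2 := fun z hz =>
    blochSum_log_one_sub_le ha j hz
  have hdiff : DifferentiableOn ℂ f (polyDisc n) := fun z hz =>
    (hasFDerivAt_log_one_sub ha j hz).differentiableAt.differentiableWithinAt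
  have hcont : ContinuousOn f (closedBall 0 1) :=
    ContinuousOn.clog (by fun_prop) fun w hw => one_sub_conj_mul_mem_slitPlane ha
      ((norm_le_pi_norm w j).trans (mem_closedBall_zero_iff.1 hw))
  obtain ⟨B, hB⟩ :=
    (isCompact_closedBall (0 : Fin n → ℂ) 1).exists_bound_of_continuousOn hcont
  have hnorm : blochNorm n f ≤ 2 := by
    simpa [hf] using blochNorm_le zero_le_two hsum
  calc ‖f (φ z) - f (ψ z)‖ ≤ supNorm n (compOpDiff n φ ψ f) :=
        norm_compOpDiff_apply_le hφm hψm
          (fun w hw => hB w (mem_closedBall_zero_iff.2 (le_of_lt hw))) hz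
    _ ≤ C * blochNorm n f := hC f (InBloch.of_blochSum_le hdiff hsum)
    _ ≤ |C| * 2 := mul_le_mul (le_abs_self C) hnorm (blochNorm_nonneg n f) (abs_nonneg C)

lemma norm_one_sub_conj_mul_le {a b : ℂ} {C : ℝ} (ha : ‖a‖ < 1) (hb : ‖b‖ < 1)
    (h : ‖Complex.log (1 - (starRingEnd ℂ) a * a) -
      Complex.log (1 - (starRingEnd ℂ) a * b)‖ ≤ C) :
    ‖1 - (starRingEnd ℂ) a * b‖ ≤ Real.exp C * (1 - ‖a‖ ^ 2) := by
  have h1 := (Complex.abs_re_le_norm _).trans h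
  have haa : 1 - (starRingEnd ℂ) a * a = ((1 - ‖a‖ ^ 2 : ℝ) : ℂ) := by
    push_cast
    rw [← Complex.conj_mul']
  have hp := one_sub_norm_sq_pos ha
  have hq := norm_pos_iff.2 (one_sub_conj_mul_ne_zero ha hb)
  rw [Complex.sub_re, Complex.log_re, Complex.log_re, haa, Complex.norm_real,
    Real.norm_of_nonneg hp.le] at h1
  rw [← Real.log_le_log_iff hq (by positivity), Real.log_mul (Real.exp_pos C).ne' hp.ne',
    Real.log_exp]
  linarith [neg_le_of_abs_le h1]

lemma exists_kobayashi_le {n : ℕ} {φ ψ : (Fin n → ℂ) → Fin n → ℂ}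
    (hφm : MapsTo φ (polyDisc n) (polyDisc n)) (hψm : MapsTo ψ (polyDisc n) (polyDisc n))
    (hbdd : IsBddOp n (compOpDiff n φ ψ)) :
    ∃ B : ℝ, ∀ z ∈ polyDisc n, kobayashi n (φ z) (ψ z) ≤ B := by
  obtain ⟨C, hC⟩ := exists_norm_log_one_sub_sub_le hφm hψm hbdd
  set R := √(1 - (Real.exp C ^ 2)⁻¹) with hR
  have hE : 0 < (Real.exp C ^ 2)⁻¹ := by positivity
  have hR1 : R < 1 := by
    rw [hR, Real.sqrt_lt' one_pos]
    linarith
  refine ⟨(1 / 2) * Real.log ((1 + R) / (1 - R)), fun z hz => ?_⟩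
  have hle : ‖mobius n (φ z) (ψ z)‖ ≤ R := by
    refine (pi_norm_le_iff_of_nonneg (Real.sqrt_nonneg _)).2 fun j => ?_
    have ha := norm_coord_lt_one (hφm hz) j
    have hb := norm_coord_lt_one (hψm hz) j
    have h1 := norm_one_sub_conj_mul_le ha hb (hC _ ha j z hz)
    have h2 := norm_one_sub_conj_mul_le (C := C) hb ha
      (by rw [norm_sub_rev]; exact hC _ hb j z hz)
    have h3 : ‖1 - (starRingEnd ℂ) (ψ z j) * φ z j‖ = ‖1 - (starRingEnd ℂ) (φ z j) * ψ z j‖ := by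
      rw [← RCLike.norm_conj]
      simp [mul_comm]
    rw [h3] at h2
    have hq := norm_pos_iff.2 (one_sub_conj_mul_ne_zero ha hb)
    have hm := one_sub_norm_sq_mobius ha hb
    have h4 : (Real.exp C ^ 2)⁻¹ ≤ 1 - ‖mobius n (φ z) (ψ z) j‖ ^ 2 := by
      rw [mobius, hm, le_div_iff₀ (by positivity), inv_mul_le_iff₀ (by positivity)]
      calc _ = ‖1 - (starRingEnd ℂ) (φ z j) * ψ z j‖ *
            ‖1 - (starRingEnd ℂ) (φ z j) * ψ z j‖ := sq _
        _ ≤ _ := mul_le_mul h1 h2 hq.le (hq.le.trans h1)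
        _ = _ := by ring
    exact Real.le_sqrt_of_sq_le (by linarith)
  have h0 := norm_nonneg (mobius n (φ z) (ψ z))
  refine mul_le_mul_of_nonneg_left (Real.log_le_log (div_pos ?_ ?_) ?_) (by norm_num)
  · linarith
  · linarith
  · gcongr

/-- Bloch functions of norm at most one form a precompact family on smaller polydiscs. -/
lemma exists_subseq_uniformly_cauchy {n : ℕ} {R : ℝ} (hR : R < 1)
    {F : ℕ → (Fin n → ℂ) → ℂ} (hF : ∀ m, InBloch n (F m) ∧ blochNorm n (F m) ≤ 1) :
    ∃ s : ℕ → ℕ, StrictMono s ∧ ∀ ε : ℝ, 0 < ε → ∃ N : ℕ, ∀ k ≥ N, ∀ k' ≥ N,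
      ∀ x : Fin n → ℂ, ‖x‖ ≤ R → ‖F (s k) x - F (s k') x‖ ≤ ε := by
  have hlip : ∀ m, ∀ x y : Fin n → ℂ, ‖x‖ ≤ R → ‖y‖ ≤ R →
      ‖F m x - F m y‖ ≤ 1 / (1 - R) * ‖x - y‖ := fun m x y hx hy =>
    norm_sub_le_mul_norm_sub (hF m).1.1
      (fun z hz => ((hF m).1.blochSum_le_blochNorm hz).trans (hF m).2) hR hx hy
  have hpos : 0 < 1 - R := by linarith
  have hbound : ∀ m, ∀ x : Fin n → ℂ, ‖x‖ ≤ R → ‖F m x‖ ≤ 1 + 1 / (1 - R) := by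
    intro m x hx
    have h1 := hlip m x 0 hx (by simpa using (norm_nonneg x).trans hx)
    have h2 := (norm_apply_zero_le_blochNorm n (F m)).trans (hF m).2
    have h3 : 1 / (1 - R) * ‖x - 0‖ ≤ 1 / (1 - R) := by
      rw [sub_zero]
      exact mul_le_of_le_one_right (by positivity) (hx.trans hR.le)
    linarith [norm_le_norm_add_norm_sub (F m 0) (F m x), norm_sub_rev (F m 0) (F m x)]
  let X := closedBall (0 : Fin n → ℂ) R
  have hX : ∀ x : X, ‖(x : Fin n → ℂ)‖ ≤ R := fun x => mem_closedBall_zero_iff.1 x.2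
  let g : ℕ → BoundedContinuousFunction X ℂ := fun m =>
    BoundedContinuousFunction.ofNormedAddCommGroup (fun x => F m x)
      (LipschitzWith.of_dist_le_mul (K := ⟨1 / (1 - R), by positivity⟩) fun x y => by
        rw [dist_eq_norm, Subtype.dist_eq, dist_eq_norm]
        exact hlip m x y (hX x) (hX y)).continuous
      (1 + 1 / (1 - R)) fun x => hbound m x (hX x)
  have hcomp : IsCompact (closure (range g)) := by
    refine BoundedContinuousFunction.arzela_ascoli (closedBall 0 (1 + 1 / (1 - R)))
      (isCompact_closedBall _ _) _ ?_ ?_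
    · rintro _ x ⟨m, rfl⟩
      exact mem_closedBall_zero_iff.2 (hbound m x (hX x))
    · refine equicontinuous_of_continuity_modulus (fun t => 1 / (1 - R) * t) ?_ _ ?_
      · exact (continuous_const.mul continuous_id).tendsto' _ _ (by simp)
      · rintro x y ⟨_, m, rfl⟩
        rw [dist_eq_norm, Subtype.dist_eq, dist_eq_norm]
        exact hlip m x y (hX x) (hX y)
  obtain ⟨_, _, s, hs, hlim⟩ :=
    hcomp.tendsto_subseq (x := g) fun m => subset_closure (mem_range_self m)
  refine ⟨s, hs, fun ε hε => ?_⟩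
  obtain ⟨N, hN⟩ := Metric.cauchySeq_iff.1 hlim.cauchySeq ε hε
  refine ⟨N, fun k hk k' hk' x hx => ?_⟩
  have h1 := (BoundedContinuousFunction.dist_coe_le_dist
    (f := g (s k)) (g := g (s k')) ⟨x, mem_closedBall_zero_iff.2 hx⟩).trans (hN k hk k' hk').le
  rwa [dist_eq_norm] at h1

lemma isCompactOp_compOpDiff_smul {n : ℕ} {φ ψ : (Fin n → ℂ) → Fin n → ℂ}
    (hφ : DifferentiableOn ℂ φ (polyDisc n)) (hφm : MapsTo φ (polyDisc n) (polyDisc n))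
    (hψ : DifferentiableOn ℂ ψ (polyDisc n)) (hψm : MapsTo ψ (polyDisc n) (polyDisc n))
    {r : ℝ} (h0 : 0 ≤ r) (h1 : r < 1) :
    IsCompactOp n fun f => compOpDiff n φ ψ fun w => f ((r : ℂ) • w) := by
  refine ⟨⟨fun f g _ _ z _ => ?_, fun c f _ z _ => ?_⟩, fun f hf => ⟨?_, ?_⟩, fun F hF => ?_⟩
  · simp only [compOpDiff, Pi.sub_apply, Pi.add_apply, Function.comp_apply]
    ring
  · simp only [compOpDiff, Pi.sub_apply, Pi.smul_apply, Function.comp_apply, smul_eq_mul]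
    ring
  · have hd := differentiableOn_comp_smul hf.1 h0 h1.le
    exact (hd.comp hφ hφm).sub (hd.comp hψ hψm)
  · obtain ⟨C, hC⟩ := exists_norm_comp_smul_le hf.1 h0 h1
    refine ⟨C + C, ?_⟩
    rintro _ ⟨z, hz, rfl⟩
    exact (norm_sub_le _ _).trans (add_le_add (hC _ (hφm hz)) (hC _ (hψm hz)))
  · obtain ⟨s, hs, hcau⟩ := exists_subseq_uniformly_cauchy h1 hF
    refine ⟨s, hs, fun ε hε => ?_⟩
    obtain ⟨N, hN⟩ := hcau (ε / 2) (half_pos hε)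
    refine ⟨N, fun k hk k' hk' => Real.iSup_le (fun z => ?_) hε.le⟩
    have hball : ∀ w ∈ polyDisc n, ‖(r : ℂ) • w‖ ≤ r := fun w hw => by
      rw [norm_smul, Complex.norm_real, Real.norm_of_nonneg h0]
      exact mul_le_of_le_one_right h0 (le_of_lt hw)
    have hφz := hN k hk k' hk' _ (hball _ (hφm z.2))
    have hψz := hN k hk k' hk' _ (hball _ (hψm z.2))
    simp only [compOpDiff, Pi.sub_apply, Function.comp_apply]
    rw [sub_sub_sub_comm]
    linarith [norm_sub_le (F (s k) ((r : ℂ) • φ z) - F (s k') ((r : ℂ) • φ z))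
      (F (s k) ((r : ℂ) • ψ z) - F (s k') ((r : ℂ) • ψ z))]

lemma supNorm_nonneg (n : ℕ) (g : (Fin n → ℂ) → ℂ) : 0 ≤ supNorm n g :=
  Real.iSup_nonneg fun _ => norm_nonneg _

lemma essNorm_le_opNorm_sub {n : ℕ} {T K : ((Fin n → ℂ) → ℂ) → (Fin n → ℂ) → ℂ}
    (hK : IsCompactOp n K) : essNorm n T ≤ opNorm n (T - K) := by
  refine csInf_le ⟨0, ?_⟩ ⟨K, hK, rfl⟩
  rintro _ ⟨K', _, rfl⟩
  refine Real.sSup_nonneg ?_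
  rintro _ ⟨f, _, _, rfl⟩
  exact supNorm_nonneg n _

lemma norm_sub_comp_smul_le {n : ℕ} {f : (Fin n → ℂ) → ℂ} {R r : ℝ} (hf : InBloch n f)
    (hf1 : blochNorm n f ≤ 1) (hR : R < 1) (h0 : 0 ≤ r) (h1 : r ≤ 1) {x : Fin n → ℂ}
    (hx : ‖x‖ ≤ R) : ‖f x - f ((r : ℂ) • x)‖ ≤ (1 - r) / (1 - R) := by
  have hrx : ‖(r : ℂ) • x‖ ≤ R := by
    rw [norm_smul, Complex.norm_real, Real.norm_of_nonneg h0]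
    exact (mul_le_of_le_one_left (norm_nonneg x) h1).trans hx
  have hpos : 0 < 1 - R := by linarith
  refine (norm_sub_le_mul_norm_sub hf.1
    (fun z hz => (hf.blochSum_le_blochNorm hz).trans hf1) hR hx hrx).trans ?_
  have h2 : x - (r : ℂ) • x = ((1 - r : ℝ) : ℂ) • x := by
    push_cast
    rw [sub_smul, one_smul]
  rw [h2, norm_smul, Complex.norm_real, Real.norm_of_nonneg (by linarith), div_mul_eq_mul_div,
    one_mul]
  gcongr
  exact mul_le_of_le_one_right (by linarith) (hx.trans hR.le)

lemma opNorm_sub_comp_smul_le {n : ℕ} {φ ψ : (Fin n → ℂ) → Fin n → ℂ}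
    (hφm : MapsTo φ (polyDisc n) (polyDisc n)) (hψm : MapsTo ψ (polyDisc n) (polyDisc n))
    {δ r A : ℝ} (hδ : 0 < δ) (h0 : 0 ≤ r) (h1 : r ≤ 1) (hA : 0 ≤ A)
    (hk : ∀ z ∈ Eset n φ ψ δ, kobayashi n (φ z) (ψ z) ≤ A) :
    opNorm n (compOpDiff n φ ψ - fun f => compOpDiff n φ ψ fun w => f ((r : ℂ) • w)) ≤
      2 * A + 2 * ((1 - r) / δ) := by
  have hnn : 0 ≤ (1 - r) / δ := div_nonneg (by linarith) hδ.le
  refine Real.sSup_le ?_ (by positivity)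
  rintro _ ⟨f, hf, hf1, rfl⟩
  refine Real.iSup_le (fun ⟨z, hz⟩ => ?_) (by positivity)
  have hM : ∀ w ∈ polyDisc n, blochSum n f w ≤ 1 := fun w hw =>
    (hf.blochSum_le_blochNorm hw).trans hf1
  change ‖f (φ z) - f (ψ z) - (f ((r : ℂ) • φ z) - f ((r : ℂ) • ψ z))‖ ≤ _
  by_cases hzE : z ∈ Eset n φ ψ δ
  · have h2 := norm_sub_le_mul_kobayashi hf.1 hM (hφm hz) (hψm hz)
    have h3 := norm_sub_le_mul_kobayashi (differentiableOn_comp_smul hf.1 h0 h1)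
      (fun w hw => (blochSum_comp_smul_le f h0 h1 hw).trans
        (hM _ (smul_mem_polyDisc hw h0 h1))) (hφm hz) (hψm hz)
    have h4 := hk z hzE
    linarith [norm_sub_le (f (φ z) - f (ψ z)) (f ((r : ℂ) • φ z) - f ((r : ℂ) • ψ z))]
  · have hmax : max ‖φ z‖ ‖ψ z‖ ≤ 1 - δ := not_lt.1 fun h => hzE ⟨hz, h⟩
    have hR : 1 - δ < 1 := by linarith
    have h2 := norm_sub_comp_smul_le hf hf1 hR h0 h1 ((le_max_left _ _).trans hmax)
    have h3 := norm_sub_comp_smul_le hf hf1 hR h0 h1 ((le_max_right _ _).trans hmax)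
    rw [sub_sub_cancel] at h2 h3
    rw [sub_sub_sub_comm]
    linarith [norm_sub_le (f (φ z) - f ((r : ℂ) • φ z)) (f (ψ z) - f ((r : ℂ) • ψ z))]

/-- **upper estimate of the essential norm.** If `φ, ψ : Uⁿ → Uⁿ` are
holomorphic and `C_φ - C_ψ : B → H^∞` is bounded, then
`‖C_φ - C_ψ‖_e ≤ 2 n² lim_{δ→0⁺} sup_{z ∈ E_δ} k_{Uⁿ}(φ(z), ψ(z))`
(the limit equals the infimum over `δ > 0`, the supremum being monotone in `δ`). -/
theorem essNorm_diff_le (n : ℕ) (hn : 0 < n)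
    (φ ψ : (Fin n → ℂ) → Fin n → ℂ)
    (hφ : DifferentiableOn ℂ φ (polyDisc n)) (hφm : MapsTo φ (polyDisc n) (polyDisc n))
    (hψ : DifferentiableOn ℂ ψ (polyDisc n)) (hψm : MapsTo ψ (polyDisc n) (polyDisc n))
    (hbdd : IsBddOp n (compOpDiff n φ ψ)) :
    essNorm n (compOpDiff n φ ψ) ≤
      2 * (n : ℝ) ^ 2 *
        ⨅ δ : {d : ℝ // 0 < d},
          sSup ((fun z => kobayashi n (φ z) (ψ z)) '' Eset n φ ψ (δ : ℝ)) := by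
  obtain ⟨B, hB⟩ := exists_kobayashi_le hφm hψm hbdd
  set S : {d : ℝ // 0 < d} → ℝ := fun δ =>
    sSup ((fun z => kobayashi n (φ z) (ψ z)) '' Eset n φ ψ (δ : ℝ))
  have hS0 : ∀ δ, 0 ≤ S δ := by
    refine fun δ => Real.sSup_nonneg ?_
    rintro _ ⟨z, hz, rfl⟩
    exact kobayashi_nonneg (hφm hz.1) (hψm hz.1)
  have hle : ∀ δ : {d : ℝ // 0 < d}, ∀ z ∈ Eset n φ ψ (δ : ℝ), kobayashi n (φ z) (ψ z) ≤ S δ := by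
    refine fun δ z hz => le_csSup ⟨B, ?_⟩ ⟨z, hz, rfl⟩
    rintro _ ⟨w, hw, rfl⟩
    exact hB w hw.1
  have hess : ∀ δ, essNorm n (compOpDiff n φ ψ) ≤ 2 * S δ := by
    intro δ
    have hlim : Tendsto (fun r : ℝ => 2 * S δ + 2 * ((1 - r) / (δ : ℝ))) (𝓝[<] 1) (𝓝 (2 * S δ)) := by
      have hc : Continuous fun r : ℝ => 2 * S δ + 2 * ((1 - r) / (δ : ℝ)) := by fun_prop
      exact (hc.tendsto' 1 _ (by simp)).mono_left nhdsWithin_le_nhds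
    refine ge_of_tendsto hlim ?_
    filter_upwards [Ioo_mem_nhdsLT (zero_lt_one' ℝ)] with r hr
    exact (essNorm_le_opNorm_sub
      (isCompactOp_compOpDiff_smul hφ hφm hψ hψm hr.1.le hr.2)).trans
      (opNorm_sub_comp_smul_le hφm hψm δ.2 hr.1.le hr.2.le (hS0 δ) (hle δ))
  have : Nonempty {d : ℝ // 0 < d} := ⟨⟨1, one_pos⟩⟩
  have h1 : essNorm n (compOpDiff n φ ψ) / 2 ≤ ⨅ δ : {d : ℝ // 0 < d}, S δ :=
    le_ciInf fun δ => by linarith [hess δ]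
  have h2 : (1 : ℝ) ≤ (n : ℝ) ^ 2 := one_le_pow₀ (by exact_mod_cast hn)
  nlinarith [Real.iInf_nonneg hS0]

end
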